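/- Let b : Fin n → ℝ satisfy b i ∈ {1, −1} for all i, and let A(k), A(k+1), …, A(k+m−1) be real n×n matrices such that each A(s) has row absolute sums equal to 1 (∑_j |A(s) i j| = 1 for all i) and is sign-consistent with b, i.e., whenever A(s) i j ≠ 0 the sign of A(s) i j equals (b i)·(b j). Then the product Φ = A(k+m−1)⋯A(k+1)A(k) satisfies Φ·b = b; in particular, 1 is an eigenvalue of Φ and the induced ℓ∞ operator norm of Φ equals 1. -/

import Mathlib

/-- The product `A(k+m-1) ⋯ A(k+1) A(k)` of the `m` matrices starting at time `k`
(the empty product for `m = 0` is the identity). -/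
def prodFrom {n : ℕ} (A : ℕ → Matrix (Fin n) (Fin n) ℝ) (k m : ℕ) :
    Matrix (Fin n) (Fin n) ℝ :=
  (List.range m).foldl (fun M r => A (k + r) * M) 1

theorem prodFrom_succ {n : ℕ} (A : ℕ → Matrix (Fin n) (Fin n) ℝ) (k m : ℕ) :
    prodFrom A k (m + 1) = A (k + m) * prodFrom A k m := by
  simp [prodFrom, List.range_succ]

theorem prodFrom_induction {n : ℕ} {P : Matrix (Fin n) (Fin n) ℝ → Prop}
    (A : ℕ → Matrix (Fin n) (Fin n) ℝ) (k m : ℕ) (one : P 1)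
    (mul : ∀ s, k ≤ s → s < k + m → ∀ M, P M → P (A s * M)) : P (prodFrom A k m) := by
  induction m with
  | zero => simpa [prodFrom] using one
  | succ m ih =>
    rw [prodFrom_succ]
    exact mul _ (by omega) (by omega) _ (ih fun s hs hs' => mul s hs (by omega))

theorem Matrix.sum_abs_mul_le_one {l m n : Type*} [Fintype m] [Fintype n]
    {M : Matrix l m ℝ} {N : Matrix m n ℝ} (hM : ∀ i, ∑ j, |M i j| ≤ 1)
    (hN : ∀ i, ∑ j, |N i j| ≤ 1) (i : l) : ∑ j, |(M * N) i j| ≤ 1 :=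
  calc ∑ j, |(M * N) i j| ≤ ∑ j, ∑ r, |M i r| * |N r j| := by
        gcongr with j
        simpa only [Matrix.mul_apply, abs_mul] using
          Finset.abs_sum_le_sum_abs (fun r => M i r * N r j) Finset.univ
    _ = ∑ r, |M i r| * ∑ j, |N r j| := by
        rw [Finset.sum_comm]
        simp only [Finset.mul_sum]
    _ ≤ ∑ r, |M i r| :=
        Finset.sum_le_sum fun r _ => mul_le_of_le_one_right (abs_nonneg _) (hN r)
    _ ≤ 1 := hM i

theorem Matrix.mulVec_eq_self_of_sign_consistent {ι : Type*} [Fintype ι] {b : ι → ℝ}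
    (hb : ∀ i, b i = 1 ∨ b i = -1) {M : Matrix ι ι ℝ} (hrow : ∀ i, ∑ j, |M i j| = 1)
    (hsign : ∀ i j, M i j ≠ 0 → M i j = |M i j| * (b i * b j)) : M.mulVec b = b := by
  ext i
  have h_entry (j : ι) : M i j * b j = |M i j| * b i := by
    have h_sq : b j * b j = 1 := by rcases hb j with h | h <;> simp [h]
    by_cases h : M i j = 0
    · simp [h]
    · linear_combination b j * hsign i j h + |M i j| * b i * h_sq
  simp only [Matrix.mulVec, dotProduct, h_entry, ← Finset.sum_mul, hrow, one_mul]

theorem Matrix.one_le_sum_abs_of_mulVec_eq_self {ι : Type*} [Fintype ι] {b : ι → ℝ}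
    (hb : ∀ i, |b i| = 1) {M : Matrix ι ι ℝ} (hM : M.mulVec b = b) (i : ι) :
    1 ≤ ∑ j, |M i j| :=
  calc (1 : ℝ) = |M.mulVec b i| := by rw [hM, hb]
    _ ≤ ∑ j, |M i j * b j| := Finset.abs_sum_le_sum_abs _ _
    _ = ∑ j, |M i j| := by simp only [abs_mul, hb, mul_one]

/-- A product of matrices with unit row absolute sums, each of which is sign-consistent
with the clustering `b` (entries `±1`), fixes the vector `b`; in particular `1` is an
eigenvalue of the product and its induced `ℓ∞` operator norm equals `1`. -/
theorem product_of_balanced_fixes_b {n : ℕ} (hn : 0 < n)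
    (b : Fin n → ℝ) (hb : ∀ i, b i = 1 ∨ b i = -1)
    (A : ℕ → Matrix (Fin n) (Fin n) ℝ) (k m : ℕ)
    (hrow : ∀ s : ℕ, k ≤ s → s < k + m → ∀ i : Fin n, ∑ j, |A s i j| = 1)
    (hsign : ∀ s : ℕ, k ≤ s → s < k + m → ∀ i j : Fin n,
      A s i j ≠ 0 → A s i j = |A s i j| * (b i * b j)) :
    (prodFrom A k m).mulVec b = b ∧
    Module.End.HasEigenvalue (Matrix.toLin' (prodFrom A k m)) 1 ∧
    (⨆ i : Fin n, ∑ j, |prodFrom A k m i j|) = 1 := by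
  have h_abs (i : Fin n) : |b i| = 1 := by rcases hb i with h | h <;> simp [h]
  have h_fix : (prodFrom A k m).mulVec b = b := by
    refine prodFrom_induction (P := fun M => M.mulVec b = b) A k m (Matrix.one_mulVec b) ?_
    intro s hs hs' M hM
    rw [← Matrix.mulVec_mulVec, hM]
    exact Matrix.mulVec_eq_self_of_sign_consistent hb (hrow s hs hs') (hsign s hs hs')
  have h_le : ∀ i, ∑ j, |prodFrom A k m i j| ≤ 1 := by
    refine prodFrom_induction (P := fun M => ∀ i, ∑ j, |M i j| ≤ 1) A k m ?_ ?_
    · intro i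
      simp [Matrix.one_apply, apply_ite abs]
    · intro s hs hs' M hM
      exact Matrix.sum_abs_mul_le_one (fun i => (hrow s hs hs' i).le) hM
  have h_eq (i : Fin n) : ∑ j, |prodFrom A k m i j| = 1 :=
    le_antisymm (h_le i) (Matrix.one_le_sum_abs_of_mulVec_eq_self h_abs h_fix i)
  refine ⟨h_fix, Module.End.hasEigenvalue_of_hasEigenvector (x := b) ⟨?_, ?_⟩, ?_⟩
  · simpa [Module.End.mem_eigenspace_iff] using h_fix
  · rintro rfl
    simpa using h_abs ⟨0, hn⟩
  · have : Nonempty (Fin n) := ⟨⟨0, hn⟩⟩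
    simp only [h_eq, ciSup_const]
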